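/- arXiv:2503.09246 — 3 statements merged into one kernel-verified Lean document; each statement's English description precedes it below -/
import Mathlib

section
/- Let w be a Ramsey witness on ℕ × ℕ. Then the image of w under the map (a, b) ↦ a + b is different from the image of w under the map (a, b) ↦ a · b (as ultrafilters on ℕ). (This is an ultrafilter formulation of Hindman's Pairwise Sum–Product Theorem: no ultrafilter all of whose members contain all pairwise sums and products from an infinite set can identify pairwise sums with pairwise products.) -/
/-- An ultrafilter on `ℕ × ℕ` is a Ramsey witness if every member contains `[H]²`
for some infinite `H ⊆ ℕ`. -/
def IsRamseyWitness (w : Ultrafilter (ℕ × ℕ)) : Prop :=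
  ∀ A ∈ w, ∃ H : Set ℕ, H.Infinite ∧ ∀ h₁ ∈ H, ∀ h₂ ∈ H, h₁ < h₂ → (h₁, h₂) ∈ A

open Filter Topology

local notation "v2" => padicValNat 2

/-- fractional part of the binary logarithm -/
noncomputable def spTheta (n : ℕ) : ℝ := Int.fract (Real.logb 2 n)

/-- distance of the binary logarithm to the integers -/
noncomputable def spDist (n : ℕ) : ℝ := ‖((Real.logb 2 n : ℝ) : UnitAddCircle)‖

/-- The finitely many sets defining the colouring. -/
def spSets : Fin 11 → Set ℕ := ![
  {n | Odd n},
  {n | Even (v2 (v2 n - 2))},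
  {n | Even (v2 (n - 4))},
  {n | v2 (n - 4) = 3},
  {n | ∃ k, n = 2 ^ k},
  {n | spDist n * (v2 n : ℝ) < 1},
  {n | |spTheta n - 1/2| < 1/4},
  {n | 0 < Real.cos (Real.pi * Real.logb 2 (spTheta n))},
  {n | 0 < Real.sin (Real.pi * Real.logb 2 (spTheta n))},
  {n | 0 < Real.cos (Real.pi * Real.logb 2 (1 - spTheta n))},
  {n | 0 < Real.sin (Real.pi * Real.logb 2 (1 - spTheta n))}]

theorem sp_v2 (i p : ℕ) : v2 (2 ^ i * (2 * p + 1)) = i := by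
  rw [padicValNat.mul (by positivity) (by omega), padicValNat.prime_pow,
    padicValNat.eq_zero_of_not_dvd (by omega)]
  rfl

theorem sp_v2_ex {n : ℕ} (hn : n ≠ 0) : ∃ p, n = 2 ^ (v2 n) * (2 * p + 1) := by
  obtain ⟨k, m, hm, rfl⟩ := Nat.exists_eq_two_pow_mul_odd hn
  obtain ⟨p, rfl⟩ := hm
  exact ⟨p, by rw [sp_v2]⟩

theorem sp_dich (u : Ultrafilter ℕ) (f : ℕ → ℕ) :
    (∃ k, ∀ᶠ a in (u : Filter ℕ), f a = k) ∨ Tendsto f u atTop := by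
  by_contra! h
  obtain ⟨h1, h2⟩ := h
  apply h2
  rw [tendsto_atTop]
  have h3 : ∀ k, ∀ᶠ a in (u : Filter ℕ), f a ≠ k := h1
  intro N
  have : ∀ᶠ a in (u : Filter ℕ), ∀ k ∈ Finset.range N, f a ≠ k :=
    (Filter.eventually_all_finset _).2 fun k _ => h3 k
  filter_upwards [this] with a ha
  by_contra hlt
  exact ha (f a) (by simpa using hlt) rfl

theorem sp_mod (u : Ultrafilter ℕ) (m : ℕ) (hm : 0 < m) :
    ∃ r, ∀ᶠ a in (u : Filter ℕ), a % m = r := by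
  rcases sp_dich u (fun a => a % m) with h | h
  · exact h
  · exfalso
    obtain ⟨a, ha⟩ := ((tendsto_atTop.1 h) m).exists
    exact absurd (Nat.mod_lt a hm) (by omega)

theorem sp_two {u : Ultrafilter ℕ} {Q : ℕ → Prop} {R : ℕ → ℕ → Prop}
    (hu : (u : Filter ℕ) ≤ atTop)
    (hQ : ∀ᶠ a in (u : Filter ℕ), Q a)
    (hR : ∀ᶠ a in (u : Filter ℕ), ∀ᶠ b in (u : Filter ℕ), R a b) (N : ℕ) :
    ∃ a b, N < a ∧ a < b ∧ Q a ∧ Q b ∧ R a b := by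
  obtain ⟨a, ha, hRa, hN⟩ := (hQ.and (hR.and (hu (eventually_gt_atTop N)))).exists
  obtain ⟨b, hb, hRb, hab⟩ := (hQ.and (hRa.and (hu (eventually_gt_atTop a)))).exists
  exact ⟨a, b, hN, hab, ha, hb, hRb⟩

theorem sp_case1 (u : Ultrafilter ℕ) (hu : (u : Filter ℕ) ≤ atTop)
    (H : ∀ i, ∀ᶠ a in (u : Filter ℕ), ∀ᶠ b in (u : Filter ℕ),
      (a + b ∈ spSets i ↔ a * b ∈ spSets i)) (k : ℕ)
    (hk : ∀ᶠ a in (u : Filter ℕ), v2 a = k) : False := by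
  have H0 := H 0
  have H1 := H 1
  have H2 := H 2
  have H3 := H 3
  simp only [spSets, Matrix.cons_val, Set.mem_ofPred_eq] at H0 H1 H2 H3
  by_cases hk0 : k = 0
  · subst hk0
    obtain ⟨a, b, ha0, hab, ha, hb, hR⟩ := sp_two hu hk H0 0
    obtain ⟨p, hp⟩ := sp_v2_ex (n := a) (by omega)
    obtain ⟨q, hq⟩ := sp_v2_ex (n := b) (by omega)
    rw [ha] at hp
    rw [hb] at hq
    have h1 : Odd a := ⟨p, by omega⟩
    have h2 : Odd b := ⟨q, by omega⟩
    have := hR.2 (h1.mul h2)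
    exact (Nat.not_odd_iff_even.2 (h1.add_odd h2)) this
  by_cases hk1 : k = 1
  · subst hk1
    rcases sp_dich u (fun a => v2 (a - 2)) with ⟨j, hj⟩ | hj
    · obtain ⟨r, hr⟩ := sp_mod u (2 ^ (j + 3)) (by positivity)
      obtain ⟨a, b, ha0, hab, ⟨ha, haj, har⟩, ⟨hb, hbj, hbr⟩, hR2, hR3⟩ :=
        sp_two hu (hk.and (hj.and hr)) (by
          filter_upwards [H2, H3] with a h2 h3
          exact h2.and h3) 5
      obtain ⟨p0, hp0⟩ := sp_v2_ex (n := a) (by omega)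
      obtain ⟨p, hp⟩ := sp_v2_ex (n := a - 2) (by omega)
      rw [ha] at hp0
      rw [haj] at hp
      have hq : ∃ q, b = a + 2 ^ (j + 3) * q := by
        have : 2 ^ (j + 3) ∣ b - a := (Nat.modEq_iff_dvd' hab.le).1 (har.trans hbr.symm)
        obtain ⟨q, hq⟩ := this
        exact ⟨q, by omega⟩
      obtain ⟨q, hq⟩ := hq
      have hj2 : 2 ≤ j := by
        by_contra hlt
        have : j = 0 ∨ j = 1 := by omega
        rcases this with rfl | rfl
        · omega
        · omega
      obtain ⟨i, rfl⟩ := Nat.exists_eq_add_of_le hj2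
      have ha' : a = 2 + 2 ^ (2 + i) * (2 * p + 1) := by omega
      have hs : a + b - 4 = 2 ^ (i + 3) * (2 * (p + 2 * q) + 1) := by
        rw [hq, ha']
        apply Nat.sub_eq_of_eq_add
        ring
      have hsv := sp_v2 (i + 3) (p + 2 * q)
      rw [← hs] at hsv
      rcases Nat.eq_zero_or_pos i with rfl | hi
      · have h3 := hR3.1 (by simpa using hsv)
        have : 16 ∣ a * b - 4 := by
          refine ⟨2 * ((2 * p + 1) * (p + 1)) + a * (2 * q), ?_⟩
          apply Nat.sub_eq_of_eq_add
          rw [hq, ha']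
          ring
        have h4 : 2 ^ 4 ∣ a * b - 4 := by simpa using this
        have hne : a * b - 4 ≠ 0 := by
          have : 5 * 5 ≤ a * b := Nat.mul_le_mul (by omega) (by omega)
          omega
        rw [padicValNat_dvd_iff_le hne] at h4
        omega
      · obtain ⟨l, rfl⟩ := Nat.exists_eq_add_of_le hi
        have hpv : a * b - 4 = 2 ^ (1 + l + 4) * (2 * (p + 2 ^ l * (2 * p + 1) * (2 * p + 1)
            + a * q) + 1) := by
          apply Nat.sub_eq_of_eq_add
          rw [hq, ha']
          ring
        have hpv' := sp_v2 (1 + l + 4) (p + 2 ^ l * (2 * p + 1) * (2 * p + 1)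
            + a * q)
        rw [← hpv] at hpv'
        rw [hsv, hpv'] at hR2
        grind
    · obtain ⟨a, ha, h2a, ha5⟩ := (hk.and (H2.and (hu (eventually_gt_atTop 5)))).exists
      obtain ⟨b, hb, hR, hb5, hbv⟩ := (hk.and (h2a.and ((Filter.Eventually.filter_mono hu (eventually_gt_atTop 5)).and
        (tendsto_atTop.1 hj (v2 (a - 2) + 3))))).exists
      obtain ⟨p, hp⟩ := sp_v2_ex (n := a - 2) (by omega)
      obtain ⟨q, hq⟩ := sp_v2_ex (n := b - 2) (by omega)
      obtain ⟨t, ht⟩ := Nat.exists_eq_add_of_le hbv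
      rw [ht] at hq
      generalize v2 (a - 2) = j at *
      obtain ⟨a', rfl⟩ : ∃ a', a = a' + 2 := ⟨a - 2, by omega⟩
      obtain ⟨b', rfl⟩ : ∃ b', b = b' + 2 := ⟨b - 2, by omega⟩
      simp only [Nat.add_sub_cancel] at hp hq
      have e1 : a' + 2 + (b' + 2) - 4 = 2 ^ j * (2 * (p + 2 ^ (2 + t) * (2 * q + 1)) + 1) := by
        apply Nat.sub_eq_of_eq_add
        rw [hp, hq]
        ring
      have e2 : (a' + 2) * (b' + 2) - 4 = 2 ^ (j + 1) * (2 * (p + 2 ^ (2 + t) * (2 * q + 1)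
          + 2 ^ (t + 1) * (2 * q + 1) * a') + 1) := by
        apply Nat.sub_eq_of_eq_add
        have : (a' + 2) * (b' + 2) = a' * b' + 2 * a' + 2 * b' + 4 := by ring
        rw [this, hq, hp]
        ring
      rw [e1, e2, sp_v2, sp_v2] at hR
      grind
  · obtain ⟨r, hr⟩ := sp_mod u (2 ^ (k + 2)) (by positivity)
    obtain ⟨a, b, ha0, hab, ⟨ha, har⟩, ⟨hb, hbr⟩, hR⟩ :=
        sp_two hu (hk.and hr) H1 0
    obtain ⟨p, hp⟩ := sp_v2_ex (n := a) (by omega)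
    rw [ha] at hp
    obtain ⟨q, hq⟩ : 2 ^ (k + 2) ∣ b - a := (Nat.modEq_iff_dvd' hab.le).1 (har.trans hbr.symm)
    have hb' : b = a + 2 ^ (k + 2) * q := by omega
    have e1 : a + b = 2 ^ (k + 1) * (2 * (p + q) + 1) := by
      rw [hb', hp]; ring
    rw [padicValNat.mul (by omega) (by omega), ha, hb, e1, sp_v2] at hR
    obtain ⟨m, rfl⟩ : ∃ m, k = m + 2 := ⟨k - 2, by omega⟩
    have e2 : m + 2 + (m + 2) - 2 = 2 ^ 1 * (m + 1) := by omega
    rw [e2, padicValNat.mul (by norm_num) (by omega), padicValNat.prime_pow] at hR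
    have e3 : m + 2 + 1 - 2 = m + 1 := by omega
    rw [e3] at hR
    grind

theorem sp_pow (u : Ultrafilter ℕ) (hu : (u : Filter ℕ) ≤ atTop)
    (H : ∀ i, ∀ᶠ a in (u : Filter ℕ), ∀ᶠ b in (u : Filter ℕ),
      (a + b ∈ spSets i ↔ a * b ∈ spSets i))
    (hp : ∀ᶠ a in (u : Filter ℕ), ∃ k, a = 2 ^ k) : False := by
  have H4 := H 4
  simp only [spSets, Matrix.cons_val, Set.mem_ofPred_eq] at H4
  obtain ⟨a, b, ha0, hab, ⟨r, rfl⟩, ⟨s, rfl⟩, hR⟩ := sp_two hu hp H4 0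
  obtain ⟨k, hk⟩ := hR.2 ⟨r + s, by ring⟩
  have h1 : 2 ^ s < 2 ^ k := by rw [← hk]; omega
  have h2 : 2 ^ k < 2 ^ (s + 1) := by rw [← hk, pow_succ]; omega
  rw [Nat.pow_lt_pow_iff_right (by norm_num)] at h1 h2
  omega

theorem sp_tlogb {x : ℝ} (hx : x ≠ 0) : Tendsto (Real.logb 2) (𝓝 x) (𝓝 (Real.logb 2 x)) :=
  (Real.continuousAt_log hx).tendsto.div_const _

/-- the log perturbation -/
theorem sp_delta (u : Ultrafilter ℕ) (hu : (u : Filter ℕ) ≤ atTop) (a : ℕ) :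
    Tendsto (fun b : ℕ => Real.logb 2 ((a + b : ℕ) : ℝ) - Real.logb 2 b) u (𝓝 0) := by
  have h1 : Tendsto (fun b : ℕ => (a : ℝ) / b) u (𝓝 0) :=
    (tendsto_const_div_atTop_nhds_zero_nat (a : ℝ)).mono_left hu
  have h2 : Tendsto (fun b : ℕ => Real.logb 2 (1 + (a : ℝ) / b)) u (𝓝 (Real.logb 2 (1 + 0))) :=
    (sp_tlogb (by norm_num)).comp (h1.const_add 1)
  simp only [add_zero, Real.logb_one] at h2
  refine h2.congr' ?_
  filter_upwards [hu (eventually_gt_atTop 0)] with b hb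
  have hb' : (0 : ℝ) < b := by exact_mod_cast hb
  rw [← Real.logb_div (by positivity) (by positivity)]
  congr 1
  push_cast
  field_simp
  ring

theorem sp_dist_pos {a : ℕ} (ha : 0 < a) (hp : ¬ ∃ k, a = 2 ^ k) : 0 < spDist a := by
  unfold spDist
  rw [norm_pos_iff]
  intro h
  rw [AddCircle.coe_eq_zero_iff] at h
  obtain ⟨n, hn⟩ := h
  have ha' : (1 : ℝ) ≤ a := by exact_mod_cast ha
  have h0 : 0 ≤ Real.logb 2 a := Real.logb_nonneg (by norm_num) ha'
  simp only [zsmul_eq_mul, mul_one] at hn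
  have hn0 : 0 ≤ n := by rw [← hn] at h0; exact_mod_cast h0
  obtain ⟨k, rfl⟩ := Int.eq_ofNat_of_zero_le hn0
  apply hp
  refine ⟨k, ?_⟩
  have := Real.rpow_logb (b := 2) (x := a) (by norm_num) (by norm_num) (by linarith)
  rw [← hn] at this
  simp only [Int.cast_natCast, Real.rpow_natCast] at this
  exact_mod_cast this.symm

theorem sp_dist_zero (u : Ultrafilter ℕ) (hu : (u : Filter ℕ) ≤ atTop)
    (H : ∀ i, ∀ᶠ a in (u : Filter ℕ), ∀ᶠ b in (u : Filter ℕ),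
      (a + b ∈ spSets i ↔ a * b ∈ spSets i))
    (hv : Tendsto (fun a => v2 a) u atTop)
    (hp : ∀ᶠ a in (u : Filter ℕ), ¬ ∃ k, a = 2 ^ k)
    (hd : Tendsto spDist u (𝓝 0)) : False := by
  have H5 := H 5
  simp only [spSets, Matrix.cons_val, Set.mem_ofPred_eq] at H5
  obtain ⟨a, ha, hR, ha0⟩ := (hp.and (H5.and (hu (eventually_gt_atTop 0)))).exists
  have hpos := sp_dist_pos ha0 ha
  have hsum : Tendsto (fun b : ℕ => (spDist b +
      |Real.logb 2 ((a + b : ℕ) : ℝ) - Real.logb 2 b|) * (v2 a : ℝ)) u (𝓝 0) := by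
    have := (hd.add (sp_delta u hu a).abs).mul_const (v2 a : ℝ)
    simpa using this
  have hvR : Tendsto (fun b : ℕ => (v2 b : ℝ)) u atTop :=
    tendsto_natCast_atTop_atTop.comp hv
  obtain ⟨b, hb, hb1, hb2, hb3, hb4, hb0⟩ := (hR.and ((hsum.eventually (gt_mem_nhds one_pos)).and
    ((hd.eventually (gt_mem_nhds (half_pos hpos))).and
    (((tendsto_atTop.1 hvR) (2 / spDist a)).and (((tendsto_atTop.1 hv) (v2 a + 1)).and
      (hu (eventually_gt_atTop 0))))))).exists
  have hvs : v2 (a + b) = v2 a := by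
    obtain ⟨p, hp⟩ := sp_v2_ex (n := a) (by omega)
    obtain ⟨q, hq⟩ := sp_v2_ex (n := b) (by omega)
    obtain ⟨t, ht⟩ := Nat.exists_eq_add_of_le hb4
    rw [ht] at hq
    generalize v2 a = j at *
    have : a + b = 2 ^ j * (2 * (p + 2 ^ t * (2 * q + 1)) + 1) := by
      rw [hp, hq]; ring
    rw [this, sp_v2]
  have hds : spDist (a + b) ≤ spDist b + |Real.logb 2 ((a + b : ℕ) : ℝ) - Real.logb 2 b| := by
    unfold spDist
    have e : ((Real.logb 2 ((a + b : ℕ) : ℝ) : ℝ) : UnitAddCircle) = ((Real.logb 2 b : ℝ) : UnitAddCircle)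
      + ((Real.logb 2 ((a + b : ℕ) : ℝ) - Real.logb 2 b : ℝ) : UnitAddCircle) := by
      rw [← AddCircle.coe_add]; congr 1; ring
    rw [e]
    refine (norm_add_le _ _).trans ?_
    gcongr
    exact QuotientAddGroup.norm_mk_le_norm
  have h1 := hb.1 (by
    rw [hvs]
    refine lt_of_le_of_lt ?_ hb1
    gcongr)
  have hdp : spDist a ≤ spDist (a * b) + spDist b := by
    unfold spDist
    have e : ((Real.logb 2 a : ℝ) : UnitAddCircle) = ((Real.logb 2 ((a * b : ℕ) : ℝ) : ℝ) : UnitAddCircle)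
      - ((Real.logb 2 b : ℝ) : UnitAddCircle) := by
      rw [← AddCircle.coe_sub]; congr 1
      push_cast
      rw [Real.logb_mul (by positivity) (by positivity)]; ring
    rw [e]
    exact norm_sub_le _ _
  rw [padicValNat.mul (by omega) (by omega)] at h1
  rw [div_le_iff₀ hpos] at hb3
  push_cast at h1
  have hva : (0 : ℝ) ≤ v2 a := by positivity
  have hvb : (0 : ℝ) ≤ v2 b := by positivity
  nlinarith

/-- sign colouring lemma -/
theorem sp_sign {F : Filter (ℕ × ℕ)} [F.NeBot] {g : ℕ → ℝ} {x : ℝ}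
    (hF : ∀ᶠ p in F, (0 < g (p.1 + p.2) ↔ 0 < g (p.1 * p.2)))
    (h1 : Tendsto (fun p : ℕ × ℕ => g (p.1 + p.2)) F (𝓝 x))
    (h2 : Tendsto (fun p : ℕ × ℕ => g (p.1 * p.2)) F (𝓝 (-x))) : x = 0 := by
  by_contra hx
  rcases lt_or_gt_of_ne hx with h | h
  · obtain ⟨p, hp, a, b⟩ := (hF.and ((h1.eventually (gt_mem_nhds h)).and
      (h2.eventually (lt_mem_nhds (neg_pos.2 h))))).exists
    exact absurd (hp.2 b) (not_lt.2 a.le)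
  · obtain ⟨p, hp, a, b⟩ := (hF.and ((h1.eventually (lt_mem_nhds h)).and
      (h2.eventually (gt_mem_nhds (neg_lt_zero.2 h))))).exists
    exact absurd (hp.1 a) (not_lt.2 b.le)

theorem sp_sign2 {F : Filter (ℕ × ℕ)} [F.NeBot] {g : ℕ → ℝ} {x : ℝ} (hx : 0 < x)
    (hF : ∀ᶠ p in F, (0 < Real.cos (Real.pi * Real.logb 2 (g (p.1 + p.2))) ↔
      0 < Real.cos (Real.pi * Real.logb 2 (g (p.1 * p.2)))))
    (hF' : ∀ᶠ p in F, (0 < Real.sin (Real.pi * Real.logb 2 (g (p.1 + p.2))) ↔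
      0 < Real.sin (Real.pi * Real.logb 2 (g (p.1 * p.2)))))
    (h1 : Tendsto (fun p : ℕ × ℕ => g (p.1 + p.2)) F (𝓝 x))
    (h2 : Tendsto (fun p : ℕ × ℕ => g (p.1 * p.2)) F (𝓝 (2 * x))) : False := by
  have l1 := ((sp_tlogb hx.ne').comp h1).const_mul Real.pi
  have l2 := ((sp_tlogb (by positivity : 2 * x ≠ 0)).comp h2).const_mul Real.pi
  have e : Real.pi * Real.logb 2 (2 * x) = Real.pi * Real.logb 2 x + Real.pi := by
    rw [Real.logb_mul (by norm_num) hx.ne', Real.logb_self_eq_one (by norm_num)]; ring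
  rw [e] at l2
  have c := sp_sign (g := fun n => Real.cos (Real.pi * Real.logb 2 (g n))) hF
    ((Real.continuous_cos.tendsto _).comp l1)
    (by rw [← Real.cos_add_pi]; exact (Real.continuous_cos.tendsto _).comp l2)
  have s := sp_sign (g := fun n => Real.sin (Real.pi * Real.logb 2 (g n))) hF'
    ((Real.continuous_sin.tendsto _).comp l1)
    (by rw [← Real.sin_add_pi]; exact (Real.continuous_sin.tendsto _).comp l2)
  have := Real.sin_sq_add_cos_sq (Real.pi * Real.logb 2 x)
  rw [c, s] at this
  norm_num at this

theorem sp_theta (u : Ultrafilter ℕ) (hu : (u : Filter ℕ) ≤ atTop)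
    (H : ∀ i, ∀ᶠ a in (u : Filter ℕ), ∀ᶠ b in (u : Filter ℕ),
      (a + b ∈ spSets i ↔ a * b ∈ spSets i))
    {x : ℝ} (hx0 : 0 < x) (hx1 : x < 1) (hx : Tendsto spTheta u (𝓝 x)) : False := by
  set F : Filter (ℕ × ℕ) := (u : Filter ℕ).curry u with hFdef
  have HF : ∀ i, ∀ᶠ p in F, (p.1 + p.2 ∈ spSets i ↔ p.1 * p.2 ∈ spSets i) := fun i =>
    Filter.eventually_curry_iff.2 (H i)
  have hfst : Tendsto Prod.fst F u := tendsto_fst.mono_left Filter.curry_le_prod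
  have hsnd : Tendsto Prod.snd F u := tendsto_snd.mono_left Filter.curry_le_prod
  have hNB : F.NeBot := by
    rw [neBot_iff]
    intro h
    have : ∀ᶠ p in F, False := by rw [h]; exact eventually_bot
    rw [hFdef, Filter.eventually_curry_iff] at this
    obtain ⟨a, ha⟩ := this.exists
    exact ha.exists.elim fun _ h => h
  have hdel : Tendsto (fun p : ℕ × ℕ => Real.logb 2 ((p.1 + p.2 : ℕ) : ℝ) - Real.logb 2 p.2) F
      (𝓝 0) := by
    intro s hs
    exact Filter.eventually_curry_iff.2 (Eventually.of_forall fun a => sp_delta u hu a hs)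
  have t1 := hx.comp hfst
  have t2 := hx.comp hsnd
  have hs : ∀ p : ℕ × ℕ, spTheta (p.1 + p.2) = Int.fract (spTheta p.2 +
      (Real.logb 2 ((p.1 + p.2 : ℕ) : ℝ) - Real.logb 2 p.2)) := by
    intro p
    unfold spTheta
    rw [Int.fract_eq_fract]
    refine ⟨⌊Real.logb 2 p.2⌋, ?_⟩
    rw [Int.fract]; ring
  have hpr : ∀ᶠ p in F, spTheta (p.1 * p.2) = Int.fract (spTheta p.1 + spTheta p.2) := by
    filter_upwards [hfst.eventually (hu (eventually_gt_atTop 0)),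
      hsnd.eventually (hu (eventually_gt_atTop 0))] with p h1 h2
    unfold spTheta
    rw [Int.fract_eq_fract]
    refine ⟨⌊Real.logb 2 p.1⌋ + ⌊Real.logb 2 p.2⌋, ?_⟩
    push_cast
    rw [Real.logb_mul (by positivity) (by positivity)]
    simp only [Int.fract]; ring
  have ts : Tendsto (fun p : ℕ × ℕ => spTheta (p.1 + p.2)) F (𝓝 x) := by
    have h := t2.add hdel
    rw [add_zero] at h
    refine h.congr' ?_
    filter_upwards [h.eventually (lt_mem_nhds hx0), h.eventually (gt_mem_nhds hx1)] with p h1 h2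
    rw [hs p]
    exact (Int.fract_eq_self.2 ⟨le_of_lt h1, h2⟩).symm
  have tp := t1.add t2
  have H6 := HF 6
  have H7 := HF 7
  have H8 := HF 8
  have H9 := HF 9
  have H10 := HF 10
  simp only [spSets, Matrix.cons_val, Set.mem_ofPred_eq] at H6 H7 H8 H9 H10
  rcases lt_trichotomy x (1/2) with hlt | heq | hgt
  · refine sp_sign2 hx0 H7 H8 ts ?_
    rw [two_mul]
    refine tp.congr' ?_
    filter_upwards [hpr, tp.eventually (lt_mem_nhds (show 0 < x + x by linarith)),
      tp.eventually (gt_mem_nhds (show x + x < 1 by linarith))] with p h0 h1 h2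
    rw [h0]
    exact (Int.fract_eq_self.2 ⟨le_of_lt h1, h2⟩).symm
  · obtain ⟨p, h6, h0, h1, h2, h3, h4⟩ := (H6.and (hpr.and
      ((tp.eventually (lt_mem_nhds (show 3/4 < x + x by linarith))).and
      ((tp.eventually (gt_mem_nhds (show x + x < 5/4 by linarith))).and
      ((ts.eventually (lt_mem_nhds (show 1/4 < x by linarith))).and
      (ts.eventually (gt_mem_nhds (show x < 3/4 by linarith)))))))).exists
    have h7 := h6.1 (by rw [abs_lt]; constructor <;> linarith)
    simp only [Function.comp] at h1 h2
    rw [h0, abs_lt] at h7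
    rcases lt_or_ge (spTheta p.1 + spTheta p.2) 1 with h8 | h8
    · rw [Int.fract_eq_self.2 ⟨by linarith, h8⟩] at h7
      linarith
    · have : Int.fract (spTheta p.1 + spTheta p.2) = spTheta p.1 + spTheta p.2 - 1 := by
        rw [← Int.fract_sub_one, Int.fract_eq_self.2 ⟨by linarith, by linarith⟩]
      rw [this] at h7
      linarith
  · refine sp_sign2 (g := fun n => 1 - spTheta n) (sub_pos.2 hx1) H9 H10 (ts.const_sub 1) ?_
    have tp' := tp.const_sub 2
    have e : 2 * (1 - x) = 2 - (x + x) := by ring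
    rw [e]
    refine tp'.congr' ?_
    filter_upwards [hpr, tp.eventually (lt_mem_nhds (show 1 < x + x by linarith)),
      tp.eventually (gt_mem_nhds (show x + x < 2 by linarith))] with p h0 h1 h2
    simp only [Function.comp] at h1 h2 ⊢
    rw [h0, ← Int.fract_sub_one, Int.fract_eq_self.2 ⟨by linarith, by linarith⟩]
    ring

theorem sp_dist_le (n : ℕ) (m : ℤ) : spDist n ≤ |spTheta n - m| := by
  unfold spDist spTheta
  have : ((Real.logb 2 n : ℝ) : UnitAddCircle) =
      ((Int.fract (Real.logb 2 n) - m : ℝ) : UnitAddCircle) := by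
    rw [← sub_eq_zero, ← AddCircle.coe_sub, AddCircle.coe_eq_zero_iff]
    refine ⟨⌊Real.logb 2 n⌋ + m, ?_⟩
    simp only [Int.fract, zsmul_eq_mul, mul_one]
    push_cast
    ring
  rw [this]
  exact QuotientAddGroup.norm_mk_le_norm

theorem sp_main (u : Ultrafilter ℕ) (hu : (u : Filter ℕ) ≤ atTop)
    (H : ∀ i, ∀ᶠ a in (u : Filter ℕ), ∀ᶠ b in (u : Filter ℕ),
      (a + b ∈ spSets i ↔ a * b ∈ spSets i)) : False := by
  rcases sp_dich u (fun a => v2 a) with ⟨k, hk⟩ | hv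
  · exact sp_case1 u hu H k hk
  by_cases hp : ∀ᶠ a in (u : Filter ℕ), ∃ k, a = 2 ^ k
  · exact sp_pow u hu H hp
  rw [← Ultrafilter.eventually_not] at hp
  have hI : ∀ n, spTheta n ∈ Set.Icc (0 : ℝ) 1 := fun n =>
    ⟨Int.fract_nonneg _, (Int.fract_lt_one _).le⟩
  obtain ⟨x, hxI, hx⟩ := (isCompact_Icc (a := (0 : ℝ)) (b := 1)).ultrafilter_le_nhds
    (u.map spTheta) (le_principal_iff.2 (Eventually.of_forall (f := (u : Filter ℕ)) hI))
  have hx' : Tendsto spTheta u (𝓝 x) := hx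
  have key : ∀ m : ℤ, x = m → False := fun m hm => by
    refine sp_dist_zero u hu H hv hp ?_
    have h := (hx'.sub_const (m : ℝ)).abs
    rw [hm, sub_self, abs_zero] at h
    exact squeeze_zero (fun n => norm_nonneg _) (fun n => sp_dist_le n m) h
  rcases hxI.1.eq_or_lt with h | h0
  · exact key 0 (by simp [← h])
  rcases hxI.2.eq_or_lt with h | h1
  · exact key 1 (by simp [h])
  exact sp_theta u hu H h0 h1 hx'

/-- Ultrafilter form of Hindman's Pairwise Sum–Product Theorem: no Ramsey witness
identifies pairwise sums with pairwise products. -/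
theorem stmt_7 (w : Ultrafilter (ℕ × ℕ)) (hw : IsRamseyWitness w) :
    (w.map fun p => p.1 + p.2) ≠ (w.map fun p => p.1 * p.2) := by
  intro heq
  have hA : ∀ i, ∀ᶠ p in (w : Filter (ℕ × ℕ)),
      (p.1 + p.2 ∈ spSets i ↔ p.1 * p.2 ∈ spSets i) := by
    intro i
    have h : (∀ᶠ p in (w : Filter (ℕ × ℕ)), p.1 + p.2 ∈ spSets i) ↔
        (∀ᶠ p in (w : Filter (ℕ × ℕ)), p.1 * p.2 ∈ spSets i) := by
      have : spSets i ∈ (w.map fun p => p.1 + p.2) ↔ spSets i ∈ (w.map fun p => p.1 * p.2) := by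
        rw [heq]
      exact this
    by_cases h1 : ∀ᶠ p in (w : Filter (ℕ × ℕ)), p.1 + p.2 ∈ spSets i
    · filter_upwards [h1, h.1 h1] with p a b
      exact iff_of_true a b
    · have h2 : ¬ ∀ᶠ p in (w : Filter (ℕ × ℕ)), p.1 * p.2 ∈ spSets i := fun h' => h1 (h.2 h')
      rw [← Ultrafilter.eventually_not] at h1 h2
      filter_upwards [h1, h2] with p a b
      exact iff_of_false a b
  obtain ⟨K, hK, hKA⟩ := hw _ (Filter.eventually_all.2 hA)
  have hne : (atTop ⊓ 𝓟 K : Filter ℕ).NeBot := by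
    rw [← Filter.frequently_mem_iff_neBot]
    exact Nat.frequently_atTop_iff_infinite.2 hK
  have hle := Ultrafilter.of_le (atTop ⊓ 𝓟 K : Filter ℕ)
  refine sp_main (Ultrafilter.of (atTop ⊓ 𝓟 K)) (hle.trans inf_le_left) ?_
  have hmem : ∀ᶠ a in (Ultrafilter.of (atTop ⊓ 𝓟 K) : Filter ℕ), a ∈ K :=
    hle (mem_inf_of_right (mem_principal_self K))
  intro i
  filter_upwards [hmem] with a ha
  filter_upwards [hmem, (hle.trans inf_le_left) (eventually_gt_atTop a)] with b hb hab
  exact hKA a ha b hb hab i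
end

section
/- Let n ≥ 1 and let f₁, …, fₙ : ℕ × ℕ → ℕ. The following are equivalent: (1) for every r ≥ 1 and every colouring c : ℕ → Fin r there exist an infinite set H ⊆ ℕ and a colour j such that c(fᵢ(h₁, h₂)) = j for all h₁, h₂ ∈ H with h₁ < h₂ and all i ∈ {1, …, n}; (2) there exists a Ramsey witness w on ℕ × ℕ such that the image ultrafilters f₁(w), …, fₙ(w) on ℕ are all equal. -/
/-- `A` contains `[H]²` for some infinite `H`. -/
def LargeSq (A : Set (ℕ × ℕ)) : Prop :=
  ∃ H : Set ℕ, H.Infinite ∧ ∀ h₁ ∈ H, ∀ h₂ ∈ H, h₁ < h₂ → (h₁, h₂) ∈ A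

theorem LargeSq.mono {A B : Set (ℕ × ℕ)} (h : LargeSq A) (hAB : A ⊆ B) : LargeSq B := by
  obtain ⟨H, h1, h2⟩ := h
  exact ⟨H, h1, fun a ha b hb hab => hAB (h2 a ha b hb hab)⟩

theorem largeSq_of_eventually (u : Ultrafilter ℕ) (hu : (u : Filter ℕ) ≤ Filter.cofinite)
    (A : Set (ℕ × ℕ)) (h : ∀ᶠ x in (u : Filter ℕ), ∀ᶠ y in (u : Filter ℕ), (x, y) ∈ A) :
    LargeSq A := by
  obtain ⟨g, -, hg⟩ := exists_seq_of_forall_finset_exists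
    (fun x => ∀ᶠ y in (u : Filter ℕ), (x, y) ∈ A) (fun x y => x < y ∧ (x, y) ∈ A) (by
      intro s hs
      have h1 : ∀ᶠ y in (u : Filter ℕ), ∀ x ∈ s, x < y ∧ (x, y) ∈ A := by
        rw [Filter.eventually_all_finset]
        intro x hx
        refine Filter.Eventually.and ?_ (hs x hx)
        apply hu
        rw [Nat.cofinite_eq_atTop]
        exact Filter.eventually_gt_atTop x
      exact (h.and h1).exists)
  have hm : StrictMono g := fun a b hab => (hg a b hab).1
  refine ⟨Set.range g, Set.infinite_range_of_injective hm.injective, ?_⟩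
  rintro _ ⟨a, rfl⟩ _ ⟨b, rfl⟩ hab
  exact (hg a b (hm.lt_iff_lt.1 hab)).2

theorem LargeSq.union {A B : Set (ℕ × ℕ)} (h : LargeSq (A ∪ B)) : LargeSq A ∨ LargeSq B := by
  obtain ⟨H, hH, hAB⟩ := h
  have : (Filter.cofinite ⊓ Filter.principal H).NeBot := hH.cofinite_inf_principal_neBot
  let u := Ultrafilter.of (Filter.cofinite ⊓ Filter.principal H)
  have hu0 : (u : Filter ℕ) ≤ Filter.cofinite ⊓ Filter.principal H := Ultrafilter.of_le _
  have hu : (u : Filter ℕ) ≤ Filter.cofinite := hu0.trans inf_le_left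
  have huH : ∀ᶠ x in (u : Filter ℕ), x ∈ H := Filter.le_principal_iff.1 (hu0.trans inf_le_right)
  have key : ∀ᶠ x in (u : Filter ℕ), (∀ᶠ y in (u : Filter ℕ), (x, y) ∈ A) ∨
      (∀ᶠ y in (u : Filter ℕ), (x, y) ∈ B) := by
    filter_upwards [huH] with x hx
    rw [← Ultrafilter.eventually_or]
    have h2 : ∀ᶠ y in (u : Filter ℕ), x < y := by
      apply hu
      rw [Nat.cofinite_eq_atTop]
      exact Filter.eventually_gt_atTop x
    filter_upwards [huH, h2] with y hy hxy
    exact hAB x hx y hy hxy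
  rw [Ultrafilter.eventually_or] at key
  exact key.imp (largeSq_of_eventually u hu A) (largeSq_of_eventually u hu B)

theorem stmt_8 (n : ℕ) (hn : 1 ≤ n) (f : Fin n → ℕ × ℕ → ℕ) :
    (∀ r : ℕ, 1 ≤ r → ∀ c : ℕ → Fin r,
      ∃ H : Set ℕ, H.Infinite ∧ ∃ j : Fin r,
        ∀ h₁ ∈ H, ∀ h₂ ∈ H, h₁ < h₂ → ∀ i : Fin n, c (f i (h₁, h₂)) = j) ↔
    (∃ w : Ultrafilter (ℕ × ℕ), IsRamseyWitness w ∧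
      ∀ i i' : Fin n, w.map (f i) = w.map (f i')) := by
  classical
  constructor
  · intro h
    let E : Finset (Set ℕ) → Set (ℕ × ℕ) := fun s =>
      {p | ∀ B ∈ s, ∀ i i' : Fin n, f i p ∈ B → f i' p ∈ B}
    have hE : ∀ s, LargeSq (E s) := by
      intro s
      let e := Fintype.equivFin (s → Prop)
      obtain ⟨H, hH, j, hj⟩ := h (Fintype.card (s → Prop)) Fintype.card_pos
        (fun x => e (fun B => x ∈ B.1))
      refine ⟨H, hH, fun a ha b hb hab B hB i i' hi => ?_⟩
      have h1 := e.injective ((hj a ha b hb hab i).trans (hj a ha b hb hab i').symm)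
      have h2 := congrFun h1 ⟨B, hB⟩
      exact h2.mp hi
    have hempty : ¬ LargeSq ∅ := by
      rintro ⟨H, hH, h2⟩
      obtain ⟨a, ha⟩ := hH.nonempty
      obtain ⟨b, hb, hab⟩ := hH.exists_gt a
      exact h2 a ha b hb hab
    let F : Filter (ℕ × ℕ) :=
      { sets := {A | ∃ s, ¬ LargeSq (E s \ A)}
        univ_sets := ⟨∅, by simpa using hempty⟩
        sets_of_superset := by
          rintro A B ⟨s, hs⟩ hAB
          exact ⟨s, fun hl => hs (hl.mono (Set.sdiff_subset_sdiff_right hAB))⟩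
        inter_sets := by
          rintro A B ⟨s, hs⟩ ⟨t, ht⟩
          refine ⟨s ∪ t, fun hl => ?_⟩
          have : LargeSq ((E s \ A) ∪ (E t \ B)) := by
            refine hl.mono ?_
            rintro p ⟨hp, hpn⟩
            by_cases hpA : p ∈ A
            · exact Or.inr ⟨fun C hC => hp C (Finset.mem_union_right _ hC),
                fun hpB => hpn ⟨hpA, hpB⟩⟩
            · exact Or.inl ⟨fun C hC => hp C (Finset.mem_union_left _ hC), hpA⟩
          exact this.union.elim hs ht }
    have hF : ∀ A, A ∈ F ↔ ∃ s, ¬ LargeSq (E s \ A) := fun A => Iff.rfl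
    have : F.NeBot := by
      refine ⟨fun hb => ?_⟩
      have : (∅ : Set (ℕ × ℕ)) ∈ F := by rw [hb]; trivial
      obtain ⟨s, hs⟩ := (hF _).1 this
      exact hs (by simpa using hE s)
    let w := Ultrafilter.of F
    have hw : (w : Filter (ℕ × ℕ)) ≤ F := Ultrafilter.of_le F
    refine ⟨w, ?_, ?_⟩
    · intro A hA
      by_contra hn
      have h1 : Aᶜ ∈ F := (hF _).2 ⟨∅, fun hl => hn (hl.mono (by
        rintro p ⟨-, hp⟩
        exact not_not.1 hp))⟩
      exact Ultrafilter.compl_notMem_iff.2 hA (hw h1)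
    · have hmem : ∀ B i i', B ∈ w.map (f i) → B ∈ w.map (f i') := by
        intro B i i' hB
        have h1 : E {B} ∈ F := (hF _).2 ⟨{B}, by simpa using hempty⟩
        rw [Ultrafilter.mem_map] at hB ⊢
        filter_upwards [hB, hw h1] with p hp hpE
        exact hpE B (Finset.mem_singleton_self B) i i' hp
      intro i i'
      ext B
      exact ⟨hmem B i i', hmem B i' i⟩
  · rintro ⟨w, hw, hmap⟩ r hr c
    let i₀ : Fin n := ⟨0, hn⟩
    obtain ⟨j, hj⟩ : ∃ j, ∀ᶠ p in (w : Filter (ℕ × ℕ)), c (f i₀ p) = j := by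
      rw [← Ultrafilter.eventually_exists_iff]
      exact Filter.Eventually.of_forall fun p => ⟨_, rfl⟩
    have hA : {p | ∀ i, c (f i p) = j} ∈ w := by
      have : ∀ᶠ p in (w : Filter (ℕ × ℕ)), ∀ i, c (f i p) = j := by
        rw [Filter.eventually_all]
        intro i
        have h1 : {x | c x = j} ∈ w.map (f i₀) := hj
        rw [hmap i₀ i] at h1
        exact h1
      exact this
    obtain ⟨H, hH, h2⟩ := hw _ hA
    exact ⟨H, hH, j, h2⟩
end

section
/- Let P, Q ∈ ℤ[X] be nonzero polynomials with P(0) = Q(0) = 0 and let a, n be positive integers. The following are equivalent: (1) the relation φ(x, y, z) := (a·xⁿ + P(y) = Q(z)), with the equation read in ℤ, is Ramsey partition regular in (x,y),z over the positive integers; (2) n = 1 and either (P = a·X and Q = a·X) or (P = −a·X and Q = −a·X); that is, a·xⁿ + P(y) − Q(z) is either a·(x + y − z) or a·(x − y + z). -/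
def RamseyPR (φ : ℕ → ℕ → ℕ → Prop) : Prop :=
  ∀ r : ℕ, ∀ col : ℕ → Fin r, ∃ j : Fin r, ∃ H : Set ℕ,
    H.Infinite ∧ (∀ h ∈ H, 0 < h ∧ col h = j) ∧
    ∀ h₁ ∈ H, ∀ h₂ ∈ H, h₁ < h₂ → ∃ z : ℕ, (0 < z ∧ col z = j) ∧ φ h₁ h₂ z

open Filter Topology

lemma rpr_finite {φ : ℕ → ℕ → ℕ → Prop} (h : RamseyPR φ) {κ : Type} [Finite κ] (col : ℕ → κ) :
    ∃ j : κ, ∃ H : Set ℕ, H.Infinite ∧ (∀ h ∈ H, 0 < h ∧ col h = j) ∧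
    ∀ h₁ ∈ H, ∀ h₂ ∈ H, h₁ < h₂ → ∃ z : ℕ, (0 < z ∧ col z = j) ∧ φ h₁ h₂ z := by
  obtain ⟨N, ⟨e⟩⟩ := Finite.exists_equiv_fin κ
  obtain ⟨j, H, hH, h1, h2⟩ := h N (fun x => e (col x))
  refine ⟨e.symm j, H, hH, ?_, ?_⟩
  · intro x hx
    exact ⟨(h1 x hx).1, by rw [Equiv.eq_symm_apply]; exact (h1 x hx).2⟩
  · intro x hx y hy hxy
    obtain ⟨z, ⟨hz, hc⟩, hφ⟩ := h2 x hx y hy hxy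
    exact ⟨z, ⟨hz, by rw [Equiv.eq_symm_apply]; exact hc⟩, hφ⟩

lemma rpr_filter {φ : ℕ → ℕ → ℕ → Prop} (h : RamseyPR φ) {κ : Type} [Finite κ] (col : ℕ → κ) :
    ∃ l : Filter ℕ, l.NeBot ∧ l ≤ atTop ∧ ∃ x : ℕ, 0 < x ∧ ∃ z : ℕ → ℕ,
      ∀ᶠ y in l, 0 < z y ∧ φ x y (z y) ∧ col (z y) = col y := by
  obtain ⟨j, H, hH, h1, h2⟩ := rpr_finite h col
  obtain ⟨x, hx⟩ := hH.nonempty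
  have h3 : ∀ y, ∃ z, y ∈ H → x < y → (0 < z ∧ φ x y z ∧ col z = col y) := by
    intro y
    by_cases hy : y ∈ H
    · by_cases hxy : x < y
      · obtain ⟨z, ⟨a, b⟩, c⟩ := h2 x hx y hy hxy
        exact ⟨z, fun _ _ => ⟨a, c, by rw [b, (h1 y hy).2]⟩⟩
      · exact ⟨0, fun _ h => absurd h hxy⟩
    · exact ⟨0, fun h => absurd h hy⟩
  choose z hz using h3
  refine ⟨atTop ⊓ 𝓟 H, ?_, inf_le_left, x, (h1 x hx).1, z, ?_⟩
  · rw [← Nat.cofinite_eq_atTop]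
    exact hH.cofinite_inf_principal_neBot
  · have e1 : ∀ᶠ y in atTop ⊓ 𝓟 H, y ∈ H := eventually_inf_principal.2 (Eventually.of_forall fun _ h => h)
    have e2 : ∀ᶠ y in atTop ⊓ 𝓟 H, x < y := (eventually_gt_atTop x).filter_mono inf_le_left
    filter_upwards [e1, e2] with y a b using hz y a b

lemma rpr_key {φ : ℕ → ℕ → ℕ → Prop} (h : RamseyPR φ) (g : ℕ → ℝ) (L : ℝ) (hL : L ≠ 0)
    (hlim : ∀ l : Filter ℕ, l.NeBot → l ≤ atTop → ∀ x : ℕ, 0 < x → ∀ z : ℕ → ℕ,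
      (∀ᶠ y in l, 0 < z y ∧ φ x y (z y)) → Tendsto (fun y => g (z y) - g y) l (𝓝 L)) : False := by
  obtain ⟨l, hl, hl', x, hx, z, hz⟩ := rpr_filter h
    (fun x => ((⌊3 / 2 * (g x / L)⌋ : ℤ) : ZMod 3))
  have ht := hlim l hl hl' x hx z (hz.mono fun y h => ⟨h.1, h.2.1⟩)
  have ht2 : Tendsto (fun y => 3 / 2 * ((g (z y) - g y) / L)) l (𝓝 (3 / 2)) := by
    have := (ht.div_const L).const_mul (3 / 2)
    rwa [div_self hL, mul_one] at this
  have e1 := ht2.eventually (lt_mem_nhds (show (1 : ℝ) < 3 / 2 by norm_num))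
  have e2 := ht2.eventually (gt_mem_nhds (show (3 / 2 : ℝ) < 2 by norm_num))
  obtain ⟨y, ⟨h0, h1⟩, h2⟩ := ((e1.and e2).and hz).exists
  have h3 := h2.2.2
  set s := 3 / 2 * (g (z y) / L) with hs
  set t := 3 / 2 * (g y / L) with ht
  have hst : 3 / 2 * ((g (z y) - g y) / L) = s - t := by rw [hs, ht]; ring
  rw [hst] at h0 h1
  rw [ZMod.intCast_eq_intCast_iff] at h3
  have a1 := Int.floor_le s
  have a2 := Int.lt_floor_add_one s
  have b1 := Int.floor_le t
  have b2 := Int.lt_floor_add_one t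
  have c1 : ⌊t⌋ < ⌊s⌋ := by
    have : (⌊t⌋ : ℝ) < ⌊s⌋ := by linarith
    exact_mod_cast this
  have c2 : ⌊s⌋ < ⌊t⌋ + 3 := by
    have : (⌊s⌋ : ℝ) < ⌊t⌋ + 3 := by linarith
    exact_mod_cast this
  unfold Int.ModEq at h3
  push_cast at h3
  omega

lemma hind (r : ℕ) (col : ℕ → Fin r) : ∃ j : Fin r, ∃ a : ℕ → ℕ, (∀ i, 0 < a i) ∧
    ∀ s : Finset ℕ, s.Nonempty → col (∑ i ∈ s, a i) = j := by
  obtain ⟨c, ⟨j, rfl⟩, a, ha⟩ := Hindman.exists_FS_of_finite_cover (M := ℕ+)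
    (Set.range fun j : Fin r => {x : ℕ+ | col x = j}) (Set.finite_range _)
    (fun x _ => ⟨_, ⟨col x, rfl⟩, rfl⟩)
  refine ⟨j, fun i => (a.get i : ℕ), fun i => (a.get i).pos, fun s hs => ?_⟩
  have key : ∀ (b : Stream' ℕ) (m : ℕ), m ∈ Hindman.FS b → ∀ a : Stream' ℕ+, 
      b = a.map (fun x : ℕ+ => (x : ℕ)) → ∃ x ∈ Hindman.FS a, (x : ℕ) = m := by
    intro b m hm
    induction hm with
    | head' b => rintro a rfl; exact ⟨a.head, Hindman.FS.head' a, rfl⟩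
    | tail' b m h ih =>
      rintro a rfl
      obtain ⟨x, hx, rfl⟩ := ih a.tail rfl
      exact ⟨x, Hindman.FS.tail' a x hx, rfl⟩
    | cons' b m h ih =>
      rintro a rfl
      obtain ⟨x, hx, rfl⟩ := ih a.tail rfl
      exact ⟨a.head + x, Hindman.FS.cons' a x hx, rfl⟩
  obtain ⟨x, hx, hx'⟩ := key _ _ (Hindman.FS.finsetSum (a.map (fun x : ℕ+ => (x : ℕ))) s hs) a rfl
  have := ha hx
  simp only [Set.mem_ofPred_eq] at this
  rw [← this, hx']
  rfl

lemma rpr_sub : RamseyPR (fun x y z => x + z = y) := by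
  intro r col
  obtain ⟨j, a, ha, hs⟩ := hind r col
  have hm : StrictMono (fun k => ∑ i ∈ Finset.range (k + 1), a i) := by
    apply strictMono_nat_of_lt_succ
    intro k
    rw [Finset.sum_range_succ _ (k + 1)]
    have := ha (k + 1)
    omega
  refine ⟨j, Set.range (fun k => ∑ i ∈ Finset.range (k + 1), a i),
    Set.infinite_range_of_injective hm.injective, ?_, ?_⟩
  · rintro _ ⟨k, rfl⟩
    exact ⟨Finset.sum_pos (fun i _ => ha i) (by simp), hs _ (by simp)⟩
  · rintro _ ⟨k, rfl⟩ _ ⟨k', rfl⟩ hlt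
    have hk := hm.lt_iff_lt.1 hlt
    refine ⟨∑ i ∈ Finset.Ico (k + 1) (k' + 1), a i,
      ⟨Finset.sum_pos (fun i _ => ha i) (by simp [hk]), hs _ (by simp [hk])⟩, ?_⟩
    exact Finset.sum_range_add_sum_Ico a (by omega)

lemma rpr_add : RamseyPR (fun x y z => x + y = z) := by
  intro r col
  obtain ⟨j, a, ha, hs⟩ := hind r col
  let S : ℕ → ℕ := fun k => ∑ i ∈ Finset.range k, a i
  let N : ℕ → ℕ := fun k => Nat.rec 0 (fun _ m => m + S m + 1) k
  have hN : ∀ k, N (k + 1) = N k + S (N k) + 1 := fun k => rfl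
  let b : ℕ → ℕ := fun k => ∑ i ∈ Finset.Ico (N k) (N (k + 1)), a i
  have hb : ∀ k, S (N k) + b k = S (N (k + 1)) := fun k =>
    Finset.sum_range_add_sum_Ico a (by rw [hN]; omega)
  have hb2 : ∀ k, S (N k) < b k := by
    intro k
    have : (Finset.Ico (N k) (N (k + 1))).card • 1 ≤ b k :=
      Finset.card_nsmul_le_sum _ _ _ (fun i _ => ha i)
    rw [Nat.card_Ico, hN, smul_eq_mul] at this
    omega
  have hm : StrictMono b := by
    apply strictMono_nat_of_lt_succ
    intro k
    have := hb k
    have := hb2 (k + 1)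
    omega
  have hNm : Monotone N := monotone_nat_of_le_succ (fun k => by rw [hN]; omega)
  have hne : ∀ k, (Finset.Ico (N k) (N (k + 1))).Nonempty := fun k => by
    rw [Finset.nonempty_Ico, hN]; omega
  refine ⟨j, Set.range b, Set.infinite_range_of_injective hm.injective, ?_, ?_⟩
  · rintro _ ⟨k, rfl⟩
    exact ⟨Finset.sum_pos (fun i _ => ha i) (hne k), hs _ (hne k)⟩
  · rintro _ ⟨k, rfl⟩ _ ⟨k', rfl⟩ hlt
    have hk : k + 1 ≤ k' := hm.lt_iff_lt.1 hlt
    have hd : Disjoint (Finset.Ico (N k) (N (k + 1))) (Finset.Ico (N k') (N (k' + 1))) := by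
      rw [Finset.disjoint_left]
      intro i h1 h2
      rw [Finset.mem_Ico] at h1 h2
      have := hNm hk
      omega
    refine ⟨b k + b k', ⟨?_, ?_⟩, rfl⟩
    · have := hb2 k; omega
    · show col (_ + _) = j
      rw [← Finset.sum_union hd]
      exact hs _ ((hne k).mono Finset.subset_union_left)

lemma nt_val (l w m : ℕ) (hl : l.Prime) (hm : ¬ l ∣ m) : padicValNat l (l ^ w * m) = w := by
  have := Fact.mk hl
  have hm0 : m ≠ 0 := by rintro rfl; simp at hm
  rw [padicValNat.mul (pow_ne_zero _ hl.ne_zero) hm0, padicValNat.prime_pow,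
    padicValNat.eq_zero_of_not_dvd hm, add_zero]

lemma nt_exists (l x : ℕ) (hl : l.Prime) (hx : 0 < x) : ∃ m, ¬ l ∣ m ∧ x = l ^ padicValNat l x * m := by
  obtain ⟨w, m, hm, h⟩ := Nat.exists_eq_pow_mul_and_not_dvd hx.ne' l hl.ne_one
  refine ⟨m, hm, ?_⟩
  conv_lhs => rw [h]
  rw [h, nt_val l w m hl hm]

lemma nt_pick (v : ℕ → ℕ) (H : Set ℕ) (hH : H.Infinite) (n : ℕ) :
    (∃ x ∈ H, ∃ y ∈ H, x < y ∧ v x = v y) ∨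
    (∃ x ∈ H, ∃ y ∈ H, x < y ∧ 0 < v x ∧ n * v x < v y) := by
  by_cases h : Set.InjOn v H
  · right
    have key : ∀ N M, ∃ y ∈ H, M < y ∧ N < v y := by
      intro N M
      by_contra! hc
      have h2 : (H \ Set.Iic M).Infinite := hH.sdiff (Set.finite_Iic M)
      have h3 : (v '' (H \ Set.Iic M)).Infinite := h2.image (h.mono Set.sdiff_subset)
      apply h3
      apply (Set.finite_Iic N).subset
      rintro _ ⟨y, ⟨hy, hy'⟩, rfl⟩
      exact hc y hy (by simpa using hy')
    obtain ⟨x, hx, -, hx'⟩ := key 0 0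
    obtain ⟨y, hy, h1, h2⟩ := key (n * v x) x
    exact ⟨x, hx, y, hy, h1, hx', h2⟩
  · left
    simp only [Set.InjOn, not_forall] at h
    obtain ⟨x, hx, y, hy, h1, h2⟩ := h
    rcases lt_or_gt_of_ne h2 with h3 | h3
    · exact ⟨x, hx, y, hy, h3, h1⟩
    · exact ⟨y, hy, x, hx, h3, h1.symm⟩

lemma nt (a n : ℕ) (ha : 0 < a) (hn : 0 < n) (p : ℤ) (hp : p ≠ 0)
    (h : RamseyPR (fun x y z => (a : ℤ) * (x : ℤ) ^ n + p * (y : ℤ) = p * (z : ℤ))) :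
    n = 1 ∧ (p = a ∨ p = -a) := by
  obtain ⟨l, hl, hlp⟩ := Nat.exists_infinite_primes (a + p.natAbs + 1)
  have := Fact.mk hlp
  have hL : Prime (l : ℤ) := Nat.prime_iff_prime_int.1 hlp
  have hz : ∀ t : ℤ, (l : ℤ) ∣ t → |t| ≤ a + |p| → t = 0 := by
    intro t h1 h2
    refine Int.eq_zero_of_abs_lt_dvd h1 ?_
    have : |p| = p.natAbs := by simp
    omega
  have hla : ¬ (l : ℤ) ∣ a := fun hd => by
    have := hz _ hd (by rw [abs_of_nonneg (by positivity)]; linarith [abs_nonneg p])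
    omega
  have hlp' : ¬ (l : ℤ) ∣ p := fun hd => hp (hz _ hd (by linarith))
  have hcop : ∀ k : ℕ, IsCoprime ((l : ℤ) ^ k) p := fun k =>
    IsCoprime.pow_left ((Prime.coprime_iff_not_dvd hL).2 hlp')
  let v : ℕ → ℕ := fun x => padicValNat l x
  obtain ⟨j, H, hH, hc, hR⟩ := rpr_finite h (fun x : ℕ =>
    (((Nat.log n (v x) : ℕ) : ZMod 2), ((x / l ^ v x : ℕ) : ZMod l),
      ((x / l ^ (n * v x) : ℕ) : ZMod l), (x : ZMod l)))
  rcases nt_pick v H hH n with ⟨x, hx, y, hy, hxy, hv⟩ | ⟨x, hx, y, hy, hxy, hv0, hv⟩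
  · obtain ⟨z, ⟨hz0, hzc⟩, heq⟩ := hR x hx y hy hxy
    have cxy := (hc x hx).2.trans (hc y hy).2.symm
    have cyz := (hc y hy).2.trans hzc.symm
    simp only [Prod.mk.injEq] at cxy cyz
    obtain ⟨m, hm, hxm⟩ := nt_exists l x hlp (hc x hx).1
    obtain ⟨m', hm', hym⟩ := nt_exists l y hlp (hc y hy).1
    change x = l ^ v x * m at hxm
    change y = l ^ v y * m' at hym
    have hlpos : ∀ k, 0 < l ^ k := fun k => pow_pos hlp.pos k
    have hmZ : ¬ (l : ℤ) ∣ m := by exact_mod_cast hm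
    have hmZ' : ¬ (l : ℤ) ∣ m' := by exact_mod_cast hm'
    rw [← hv] at hym
    have hxd : x / l ^ v x = m := by
      conv_lhs => enter [1]; rw [hxm]
      exact Nat.mul_div_cancel_left _ (hlpos _)
    have hyd : y / l ^ v x = m' := by
      conv_lhs => enter [1]; rw [hym]
      exact Nat.mul_div_cancel_left _ (hlpos _)
    have hmm : (m : ZMod l) = m' := by
      have := cxy.2.1
      rwa [← hv, hxd, hyd] at this
    rw [← hv] at cyz
    rw [hyd] at cyz
    set w := v x with hw
    clear_value w
    by_cases hn1 : n = 1
    · refine ⟨hn1, Or.inr ?_⟩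
      subst hn1
      have hfact : p * (z : ℤ) = (l : ℤ) ^ w * (a * m + p * m') := by
        rw [← heq, hxm, hym]; push_cast; ring
      have hdz : (l : ℤ) ^ w ∣ z := (hcop w).dvd_of_dvd_mul_left ⟨_, hfact⟩
      have hdz' : l ^ w ∣ z := by exact_mod_cast hdz
      obtain ⟨t, rfl⟩ := hdz'
      have ht : p * (t : ℤ) = a * m + p * m' := by
        have h0 : (l : ℤ) ^ w ≠ 0 := pow_ne_zero _ hL.ne_zero
        apply mul_left_cancel₀ h0
        rw [← hfact]; push_cast; ring
      have htc : (p : ZMod l) * t = (a + p) * m := by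
        have := congrArg (fun u : ℤ => (u : ZMod l)) ht
        push_cast at this
        rw [this, ← hmm]; ring
      by_cases hlt : l ∣ t
      · have h1 : (t : ZMod l) = 0 := (ZMod.natCast_eq_zero_iff _ _).2 hlt
        have h2 : (m : ZMod l) ≠ 0 := fun h => hm ((ZMod.natCast_eq_zero_iff _ _).1 h)
        rw [h1, mul_zero] at htc
        have h3 : (a + p : ZMod l) = 0 := by
          rcases mul_eq_zero.1 htc.symm with h | h
          · exact h
          · exact absurd h h2
        have h4 : (l : ℤ) ∣ (a + p) := by
          rw [← ZMod.intCast_zmod_eq_zero_iff_dvd]; push_cast; exact h3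
        have := hz _ h4 (by
          refine (abs_add_le _ _).trans ?_
          simp)
        linarith
      · have hvz : v (l ^ w * t) = w := nt_val l w t hlp hlt
        have h1 := cyz.2.1
        rw [hvz, Nat.mul_div_cancel_left _ (hlpos _), ← hmm] at h1
        rw [← h1] at htc
        have h2 : (m : ZMod l) ≠ 0 := fun h => hm ((ZMod.natCast_eq_zero_iff _ _).1 h)
        have h3 : (a : ZMod l) * m = 0 := by linear_combination -htc
        rcases mul_eq_zero.1 h3 with h | h
        · exact absurd (by exact_mod_cast (ZMod.natCast_eq_zero_iff _ _).1 h) hla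
        · exact absurd h h2
    · exfalso
      have hfact : p * ((z : ℤ) - y) = (l : ℤ) ^ (n * w) * (a * m ^ n) := by
        have : p * ((z : ℤ) - y) = a * (x : ℤ) ^ n := by linarith
        rw [this, hxm]; push_cast; rw [mul_pow, ← pow_mul, mul_comm n w]; ring
      obtain ⟨s, hs⟩ : (l : ℤ) ^ (n * w) ∣ (z : ℤ) - y :=
        (hcop _).dvd_of_dvd_mul_left ⟨_, hfact⟩
      have hps : p * s = a * m ^ n := by
        have h0 : (l : ℤ) ^ (n * w) ≠ 0 := pow_ne_zero _ hL.ne_zero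
        apply mul_left_cancel₀ h0
        rw [← hfact, hs]; ring
      have hls : ¬ (l : ℤ) ∣ s := by
        intro hd
        have : (l : ℤ) ∣ a * m ^ n := hps ▸ hd.mul_left p
        rcases hL.dvd_or_dvd this with h | h
        · exact hla h
        · exact hmZ (hL.dvd_of_dvd_pow h)
      have hvz : w ≠ 0 → v z = w := by
        intro hw0
        have hnw : w + 1 ≤ n * w := by
          have : 2 * w ≤ n * w := Nat.mul_le_mul_right _ (by omega)
          omega
        obtain ⟨k, hk⟩ := Nat.exists_eq_add_of_le hnw
        have hzz : (z : ℤ) = (l : ℤ) ^ w * (m' + l * (l ^ k * s)) := by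
          have : (z : ℤ) = y + l ^ (n * w) * s := by linarith
          rw [this, hk, hym]; push_cast; ring
        obtain ⟨t, rfl⟩ : l ^ w ∣ z := by
          have : (l : ℤ) ^ w ∣ z := ⟨_, hzz⟩
          exact_mod_cast this
        apply nt_val l w t hlp
        intro hd
        have ht : (t : ℤ) = m' + l * (l ^ k * s) := by
          have h0 : (l : ℤ) ^ w ≠ 0 := pow_ne_zero _ hL.ne_zero
          apply mul_left_cancel₀ h0
          rw [← hzz]; push_cast; ring
        have hd' : (l : ℤ) ∣ t := by exact_mod_cast hd
        rw [ht] at hd'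
        exact hmZ' ((dvd_add_left (dvd_mul_right _ _)).1 hd')
      apply hls
      rw [← ZMod.intCast_zmod_eq_zero_iff_dvd]
      by_cases hw0 : w = 0
      · have h1 := cyz.2.2.2
        rw [hw0] at hs
        have := congrArg (fun u : ℤ => (u : ZMod l)) hs
        simp at this
        rw [← this, h1, sub_self]
      · have h1 := cyz.2.2.1
        rw [hvz hw0] at h1
        have h2 : ((z / l ^ (n * w) : ℕ) : ℤ) = (y / l ^ (n * w) : ℕ) + s := by
          push_cast
          rw [show (z : ℤ) = y + l ^ (n * w) * s by linarith,
            Int.add_mul_ediv_left _ _ (pow_ne_zero _ hL.ne_zero)]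
        have := congrArg (fun u : ℤ => (u : ZMod l)) h2
        simp only [Int.cast_add, Int.cast_natCast] at this
        rw [← h1] at this
        simpa using this
  · obtain ⟨z, ⟨hz0, hzc⟩, heq⟩ := hR x hx y hy hxy
    have cxz := (hc x hx).2.trans hzc.symm
    simp only [Prod.mk.injEq] at cxz
    obtain ⟨m, hm, hxm⟩ := nt_exists l x hlp (hc x hx).1
    obtain ⟨m', hm', hym⟩ := nt_exists l y hlp (hc y hy).1
    change x = l ^ v x * m at hxm
    change y = l ^ v y * m' at hym
    have hlpos : ∀ k, 0 < l ^ k := fun k => pow_pos hlp.pos k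
    have hmZ : ¬ (l : ℤ) ∣ m := by exact_mod_cast hm
    have hxd : x / l ^ v x = m := by
      conv_lhs => enter [1]; rw [hxm]
      exact Nat.mul_div_cancel_left _ (hlpos _)
    rw [hxd] at cxz
    set w := v x with hw
    clear_value w
    obtain ⟨k, hk⟩ := Nat.exists_eq_add_of_le (Nat.succ_le_of_lt hv)
    have hfact : p * (z : ℤ) = (l : ℤ) ^ (n * w) * (a * m ^ n + l * (p * l ^ k * m')) := by
      rw [← heq, hxm, hym, hk]; push_cast
      rw [mul_pow, ← pow_mul, mul_comm w n, Nat.succ_eq_add_one]; ring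
    have hdz : (l : ℤ) ^ (n * w) ∣ z := (hcop _).dvd_of_dvd_mul_left ⟨_, hfact⟩
    have hdz' : l ^ (n * w) ∣ z := by exact_mod_cast hdz
    obtain ⟨t, rfl⟩ := hdz'
    have ht : p * (t : ℤ) = a * m ^ n + l * (p * l ^ k * m') := by
      have h0 : (l : ℤ) ^ (n * w) ≠ 0 := pow_ne_zero _ hL.ne_zero
      apply mul_left_cancel₀ h0
      rw [← hfact]; push_cast; ring
    have hlt : ¬ l ∣ t := by
      intro hd
      have hd' : (l : ℤ) ∣ p * t := Dvd.dvd.mul_left (by exact_mod_cast hd) p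
      rw [ht] at hd'
      rcases hL.dvd_or_dvd ((dvd_add_left (dvd_mul_right _ _)).1 hd') with h | h
      · exact hla h
      · exact hmZ (hL.dvd_of_dvd_pow h)
    have hvz : v (l ^ (n * w) * t) = n * w := nt_val l _ t hlp hlt
    rw [hvz] at cxz
    by_cases hn1 : n = 1
    · refine ⟨hn1, Or.inl ?_⟩
      subst hn1
      have h1 := cxz.2.1
      rw [Nat.mul_div_cancel_left _ (hlpos _)] at h1
      have htc := congrArg (fun u : ℤ => (u : ZMod l)) ht
      simp at htc
      rw [← h1] at htc
      have h2 : (m : ZMod l) ≠ 0 := fun h => hm ((ZMod.natCast_eq_zero_iff _ _).1 h)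
      have h3 := mul_right_cancel₀ h2 htc
      have h4 : (l : ℤ) ∣ (p - a) := by
        rw [← ZMod.intCast_zmod_eq_zero_iff_dvd]; push_cast; rw [h3, sub_self]
      have := hz _ h4 (by
        refine (abs_sub _ _).trans ?_
        simp [add_comm])
      linarith
    · exfalso
      have h1 := cxz.1
      rw [mul_comm n w, Nat.log_mul_base (by omega) (by omega)] at h1
      push_cast at h1
      simp at h1

open Polynomial in
lemma as_coeff (R : ℝ[X]) (k : ℕ) (hk : R.natDegree ≤ k) :
    Tendsto (fun y : ℝ => R.eval y / y ^ k) atTop (𝓝 (R.coeff k)) := by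
  by_cases hR : R = 0
  · simp [hR]
  rcases hk.lt_or_eq with h | h
  · rw [coeff_eq_zero_of_natDegree_lt h]
    have := div_tendsto_atTop_zero_of_degree_lt R (X ^ k) (by
      rw [degree_X_pow]; exact (natDegree_lt_iff_degree_lt hR).1 h)
    simpa using this
  · have := div_tendsto_atTop_leadingCoeff_div_of_degree_eq R (X ^ k) (by
      rw [degree_X_pow, degree_eq_natDegree hR, h])
    simp only [leadingCoeff, h] at this
    simpa using this

lemma as_cast {l : Filter ℕ} (hl : l ≤ atTop) : Tendsto (fun y : ℕ => (y : ℝ)) l atTop :=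
  tendsto_natCast_atTop_atTop.mono_left hl

open Polynomial in
lemma as1 (F G : ℝ[X]) (hF : 0 < F.natDegree) {l : Filter ℕ} (hl : l ≤ atTop)
    (z : ℕ → ℕ) (h : ∀ᶠ y : ℕ in l, F.eval (y : ℝ) = G.eval (z y : ℝ)) : Tendsto z l atTop := by
  rw [tendsto_atTop]
  intro N
  have h1 := (F.abs_tendsto_atTop (natDegree_pos_iff_degree_pos.1 hF)).comp (as_cast hl)
  have h2 := h1.eventually (eventually_gt_atTop (∑ i ∈ Finset.range N, |G.eval (i : ℝ)|))
  filter_upwards [h, h2] with y hy hy2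
  by_contra hc
  have h3 : |G.eval (z y : ℝ)| ≤ ∑ i ∈ Finset.range N, |G.eval (i : ℝ)| :=
    Finset.single_le_sum (f := fun i : ℕ => |G.eval (i : ℝ)|) (fun i _ => abs_nonneg _)
      (Finset.mem_range.2 (not_le.1 hc))
  simp only [Function.comp] at hy2
  rw [hy] at hy2
  linarith

open Polynomial in
lemma as2 (F G : ℝ[X]) (hF : 0 < F.natDegree) (hG : 0 < G.natDegree) {l : Filter ℕ} (hn : l.NeBot)
    (hl : l ≤ atTop)
    (z : ℕ → ℕ) (h : ∀ᶠ y : ℕ in l, F.eval (y : ℝ) = G.eval (z y : ℝ)) :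
    0 < F.leadingCoeff / G.leadingCoeff ∧
    Tendsto (fun y : ℕ => G.natDegree * Real.log (z y) - F.natDegree * Real.log y) l
      (𝓝 (Real.log (F.leadingCoeff / G.leadingCoeff))) := by
  have hz := as1 F G hF hl z h
  have hzR : Tendsto (fun y => (z y : ℝ)) l atTop := tendsto_natCast_atTop_atTop.comp hz
  have hyR := as_cast hl
  have hF0 : F.leadingCoeff ≠ 0 := by
    rw [leadingCoeff_ne_zero]; rintro rfl; simp at hF
  have hG0 : G.leadingCoeff ≠ 0 := by
    rw [leadingCoeff_ne_zero]; rintro rfl; simp at hG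
  have hf := (as_coeff F _ le_rfl).comp hyR
  have hg := (as_coeff G _ le_rfl).comp hzR
  have hq := hf.div hg hG0
  have hq2 : Tendsto (fun y : ℕ => (z y : ℝ) ^ G.natDegree / (y : ℝ) ^ F.natDegree) l
      (𝓝 (F.leadingCoeff / G.leadingCoeff)) := by
    refine hq.congr' ?_
    have e3 := hg.eventually_ne hG0
    filter_upwards [h, hyR.eventually_gt_atTop 0, hzR.eventually_gt_atTop 0, e3] with y hy h1 h2 h3
    simp only [Function.comp, Pi.div_apply] at h3 ⊢
    have h4 : G.eval (z y : ℝ) ≠ 0 := by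
      intro h0; rw [h0, zero_div] at h3; exact h3 rfl
    rw [hy]
    field_simp
  have hpos : 0 < F.leadingCoeff / G.leadingCoeff := by
    refine lt_of_le_of_ne ?_ (div_ne_zero hF0 hG0).symm
    exact ge_of_tendsto' hq2 (fun y => by positivity)
  refine ⟨hpos, ?_⟩
  refine ((Real.continuousAt_log hpos.ne').tendsto.comp hq2).congr' ?_
  filter_upwards [hyR.eventually_gt_atTop 0, hzR.eventually_gt_atTop 0] with y h1 h2
  simp only [Function.comp]
  rw [Real.log_div (by positivity) (by positivity), Real.log_pow, Real.log_pow]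

lemma as3 (e d : ℕ) (he : 0 < e) (hd : 0 < d) (c : ℝ) {l : Filter ℕ}
    (hl : l ≤ atTop) (z : ℕ → ℕ) (hz : Tendsto z l atTop)
    (h : Tendsto (fun y : ℕ => d * Real.log (z y) - e * Real.log y) l (𝓝 c)) :
    Tendsto (fun y : ℕ => Real.log (Real.log (z y)) - Real.log (Real.log y)) l
      (𝓝 (Real.log (e / d))) := by
  have hzR : Tendsto (fun y => Real.log (z y : ℝ)) l atTop :=
    Real.tendsto_log_atTop.comp (tendsto_natCast_atTop_atTop.comp hz)
  have hyR : Tendsto (fun y : ℕ => Real.log (y : ℝ)) l atTop := Real.tendsto_log_atTop.comp (as_cast hl)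
  have hd' : (d : ℝ) ≠ 0 := by positivity
  have h1 : Tendsto (fun y : ℕ => Real.log (z y) / Real.log y) l (𝓝 (e / d)) := by
    have h2 := ((h.div_atTop hyR).add_const (e : ℝ)).div_const (d : ℝ)
    rw [zero_add] at h2
    refine h2.congr' ?_
    filter_upwards [hyR.eventually_gt_atTop 0] with y hy
    field_simp
    ring
  refine ((Real.continuousAt_log (by positivity)).tendsto.comp h1).congr' ?_
  filter_upwards [hyR.eventually_gt_atTop 0, hzR.eventually_gt_atTop 0] with y h1 h2
  simp only [Function.comp]
  rw [Real.log_div h2.ne' h1.ne']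

open Polynomial in
lemma as_mvt (G : ℝ[X]) (u v : ℝ) : ∃ ξ, |ξ - u| ≤ |v - u| ∧
    G.eval v - G.eval u = G.derivative.eval ξ * (v - u) := by
  rcases lt_trichotomy u v with h | h | h
  · obtain ⟨c, hc, h2⟩ := exists_hasDerivAt_eq_slope (fun x => G.eval x) (fun x => G.derivative.eval x)
      h G.continuous.continuousOn (fun x _ => G.hasDerivAt x)
    refine ⟨c, ?_, ?_⟩
    · rw [abs_of_pos (by linarith [hc.1]), abs_of_pos (by linarith)]; linarith [hc.2]
    · rw [h2, div_mul_cancel₀ _ (by linarith)]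
  · exact ⟨u, by simp, by simp [h]⟩
  · obtain ⟨c, hc, h2⟩ := exists_hasDerivAt_eq_slope (fun x => G.eval x) (fun x => G.derivative.eval x)
      h G.continuous.continuousOn (fun x _ => G.hasDerivAt x)
    refine ⟨c, ?_, ?_⟩
    · rw [abs_of_neg (by linarith [hc.2]), abs_of_neg (by linarith)]; linarith [hc.1]
    · have : u - v ≠ 0 := by linarith
      rw [h2]; field_simp; ring

open Polynomial in
lemma as5 (F G : ℝ[X]) (d : ℕ) (hF : F.natDegree = d + 1) (hG : G.natDegree = d + 1)
    (hlc : F.leadingCoeff = G.leadingCoeff) {l : Filter ℕ} (hn : l.NeBot)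
    (hl : l ≤ atTop)
    (z : ℕ → ℕ) (h : ∀ᶠ y : ℕ in l, F.eval (y : ℝ) = G.eval (z y : ℝ)) :
    Tendsto (fun y : ℕ => (z y : ℝ) - y) l
      (𝓝 ((F - G).coeff d / ((d + 1) * G.leadingCoeff))) := by
  have hz := as1 F G (by omega) hl z h
  have hzR : Tendsto (fun y => (z y : ℝ)) l atTop := tendsto_natCast_atTop_atTop.comp hz
  have hyR := as_cast hl
  have hG0 : G.leadingCoeff ≠ 0 := by
    rw [leadingCoeff_ne_zero]; rintro rfl; simp at hG
  have h2 := (as2 F G (by omega) (by omega) hn hl z h).2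
  rw [hlc, div_self hG0, Real.log_one, hF, hG] at h2
  have hd' : ((d + 1 : ℕ) : ℝ) ≠ 0 := by positivity
  have hratio : Tendsto (fun y : ℕ => (z y : ℝ) / y) l (𝓝 1) := by
    have h3 := (Real.continuous_exp.tendsto 0).comp (by simpa using h2.div_const ((d + 1 : ℕ) : ℝ))
    rw [Real.exp_zero] at h3
    refine h3.congr' ?_
    filter_upwards [hyR.eventually_gt_atTop 0, hzR.eventually_gt_atTop 0] with y h1 h2
    simp only [Function.comp]
    have : (((d : ℝ) + 1) * Real.log (z y) - (d + 1) * Real.log y) / (d + 1)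
        = Real.log (z y) - Real.log y := by
      field_simp
    rw [this, Real.exp_sub, Real.exp_log h1, Real.exp_log h2]
  have hm := fun y : ℕ => as_mvt G y (z y)
  choose ξ hξ1 hξ2 using hm
  have hξr : Tendsto (fun y : ℕ => ξ y / y) l (𝓝 1) := by
    rw [tendsto_iff_norm_sub_tendsto_zero] at hratio ⊢
    refine squeeze_zero' (Eventually.of_forall fun _ => norm_nonneg _) ?_ hratio
    filter_upwards [hyR.eventually_gt_atTop 0] with y h1
    rw [Real.norm_eq_abs, Real.norm_eq_abs, div_sub_one h1.ne', div_sub_one h1.ne', abs_div, abs_div]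
    exact div_le_div_of_nonneg_right (hξ1 y) (abs_nonneg _)
  have hξt : Tendsto ξ l atTop := by
    refine (hyR.atTop_mul_pos one_pos hξr).congr' ?_
    filter_upwards [hyR.eventually_gt_atTop 0] with y h1
    field_simp
  have hD : G.derivative.natDegree ≤ d := by
    have := natDegree_derivative_le G
    omega
  have hDc : G.derivative.coeff d = (d + 1) * G.leadingCoeff := by
    rw [coeff_derivative, leadingCoeff, hG]; ring
  have hDt : Tendsto (fun y : ℕ => G.derivative.eval (ξ y) / (y : ℝ) ^ d) l
      (𝓝 ((d + 1) * G.leadingCoeff)) := by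
    have := ((as_coeff _ d hD).comp hξt).mul (hξr.pow d)
    rw [one_pow, mul_one, hDc] at this
    refine this.congr' ?_
    filter_upwards [hyR.eventually_gt_atTop 0, hξt.eventually_gt_atTop 0] with y h1 h2
    simp only [Function.comp]
    rw [div_pow]
    field_simp
  have hRd : (F - G).natDegree ≤ d := by
    by_contra hc
    have hc1 : (F - G).natDegree ≤ d + 1 := (natDegree_sub_le F G).trans (by simp [hF, hG])
    have hc2 : (F - G).natDegree = d + 1 := by omega
    have : (F - G).leadingCoeff = 0 := by
      rw [leadingCoeff, hc2, coeff_sub]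
      rw [leadingCoeff, leadingCoeff, hF, hG] at hlc
      rw [hlc, sub_self]
    rw [leadingCoeff_eq_zero] at this
    rw [this] at hc2
    simp at hc2
  have hRt := (as_coeff _ d hRd).comp hyR
  have hne : ((d : ℝ) + 1) * G.leadingCoeff ≠ 0 := mul_ne_zero (by positivity) hG0
  refine (hRt.div hDt hne).congr' ?_
  filter_upwards [h, hyR.eventually_gt_atTop 0, hDt.eventually_ne hne] with y hy h1 h3
  simp only [Function.comp, Pi.div_apply]
  have h4 : G.derivative.eval (ξ y) ≠ 0 := by
    intro h0; rw [h0, zero_div] at h3; exact h3 rfl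
  rw [eval_sub, hy, hξ2]
  field_simp

open Polynomial in
lemma fwd (P Q : ℤ[X]) (hP : P ≠ 0) (hQ : Q ≠ 0)
    (hP0 : P.eval 0 = 0) (hQ0 : Q.eval 0 = 0) (a n : ℕ) (ha : 0 < a)
    (h : RamseyPR (fun x y z => (a : ℤ) * (x : ℤ) ^ n + P.eval (y : ℤ) = Q.eval (z : ℤ))) :
    ∃ p : ℤ, p ≠ 0 ∧ P = C p * X ∧ Q = C p * X := by
  have hPc : P.coeff 0 = 0 := by rw [coeff_zero_eq_eval_zero, hP0]
  have hQc : Q.coeff 0 = 0 := by rw [coeff_zero_eq_eval_zero, hQ0]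
  have hpos : ∀ R : ℤ[X], R ≠ 0 → R.coeff 0 = 0 → 0 < R.natDegree := by
    intro R hR h0
    by_contra hc
    apply hR
    rw [eq_C_of_natDegree_eq_zero (by omega : R.natDegree = 0), h0, C_0]
  have hPd := hpos P hP hPc
  have hQd := hpos Q hQ hQc
  let F : ℕ → ℝ[X] := fun x => (P + C ((a : ℤ) * (x : ℤ) ^ n)).map (Int.castRingHom ℝ)
  let G : ℝ[X] := Q.map (Int.castRingHom ℝ)
  have hinj : Function.Injective (Int.castRingHom ℝ) := Int.cast_injective
  have hGd : G.natDegree = Q.natDegree := natDegree_map_eq_of_injective hinj Q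
  have hGl : G.leadingCoeff = Q.leadingCoeff := by
    simp [G, leadingCoeff_map_of_injective hinj]
  have hFd : ∀ x, (F x).natDegree = P.natDegree := fun x => by
    simp only [F]
    rw [natDegree_map_eq_of_injective hinj, natDegree_add_C]
  have hFl : ∀ x, (F x).leadingCoeff = P.leadingCoeff := fun x => by
    rw [leadingCoeff, hFd]
    simp only [F]
    rw [coeff_map, coeff_add, coeff_C_of_ne_zero (by omega)]
    simp
  have heq : ∀ x y z : ℕ, (a : ℤ) * (x : ℤ) ^ n + P.eval (y : ℤ) = Q.eval (z : ℤ) →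
      (F x).eval (y : ℝ) = G.eval (z : ℝ) := by
    intro x y z hxyz
    have e1 : ∀ (R : ℤ[X]) (t : ℕ), (R.map (Int.castRingHom ℝ)).eval (t : ℝ) = ((R.eval (t : ℤ) : ℤ) : ℝ) := by
      intro R t
      have := eval_intCast_map (Int.castRingHom ℝ) R (t : ℤ)
      simpa using this
    simp only [F, G]
    rw [e1, e1, ← hxyz]
    simp [add_comm]
  -- degrees
  have hed : P.natDegree = Q.natDegree := by
    by_contra hne
    refine rpr_key h (fun x => Real.log (Real.log x)) (Real.log (P.natDegree / Q.natDegree)) ?_ ?_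
    · have h1 : (0 : ℝ) < P.natDegree / Q.natDegree := by positivity
      refine Real.log_ne_zero_of_pos_of_ne_one h1 ?_
      rw [Ne, div_eq_one_iff_eq (by positivity)]
      exact_mod_cast hne
    · intro l hn hl x hx z hz
      have hz' := hz.mono fun y hy => heq x y (z y) hy.2
      have := (as2 (F x) G (by rw [hFd]; exact hPd) (by rw [hGd]; exact hQd) hn hl z hz').2
      rw [hFd, hGd] at this
      exact as3 _ _ hPd hQd _ hl z (as1 (F x) G (by rw [hFd]; exact hPd) hl z hz') this
  have hQl0 : (Q.leadingCoeff : ℝ) ≠ 0 := by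
    exact_mod_cast (leadingCoeff_ne_zero.2 hQ)
  have hlc : P.leadingCoeff = Q.leadingCoeff := by
    by_contra hne
    have hdR : (Q.natDegree : ℝ) ≠ 0 := by positivity
    have hpos : (0 : ℝ) < P.leadingCoeff / Q.leadingCoeff := by
      obtain ⟨l, hn, hl, x, hx, z, hz⟩ := rpr_filter h (fun _ => ())
      have hz' := hz.mono fun y hy => heq x y (z y) hy.2.1
      have := (as2 (F x) G (by rw [hFd]; exact hPd) (by rw [hGd]; exact hQd) hn hl z hz').1
      rwa [hFl, hGl] at this
    refine rpr_key h (fun x => Real.log x)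
      (Real.log (P.leadingCoeff / Q.leadingCoeff) / Q.natDegree) ?_ ?_
    · refine div_ne_zero (Real.log_ne_zero_of_pos_of_ne_one hpos ?_) hdR
      rw [Ne, div_eq_one_iff_eq hQl0]
      exact_mod_cast hne
    · intro l hn hl x hx z hz
      have hz' := hz.mono fun y hy => heq x y (z y) hy.2
      have := (as2 (F x) G (by rw [hFd]; exact hPd) (by rw [hGd]; exact hQd) hn hl z hz').2
      rw [hFd, hGd, hFl, hGl, hed] at this
      refine (this.div_const (Q.natDegree : ℝ)).congr ?_
      intro y
      field_simp
  have hd1 : Q.natDegree = 1 := by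
    by_contra hne
    obtain ⟨d, hd⟩ : ∃ d, Q.natDegree = d + 1 + 1 := ⟨Q.natDegree - 2, by omega⟩
    have key : ∀ l : Filter ℕ, l.NeBot → l ≤ atTop → ∀ x : ℕ, 0 < x → ∀ z : ℕ → ℕ,
      (∀ᶠ y in l, 0 < z y ∧ (a : ℤ) * (x : ℤ) ^ n + P.eval (y : ℤ) = Q.eval (z y : ℤ)) →
        Tendsto (fun y => (z y : ℝ) - (y : ℝ)) l (𝓝 (((P - Q).coeff (d + 1) : ℝ) /
          (((d + 1 : ℕ) + 1) * Q.leadingCoeff))) := by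
      intro l hn hl x hx z hz
      have hz' := hz.mono fun y hy => heq x y (z y) hy.2
      have := as5 (F x) G (d + 1) (by rw [hFd, hed, hd]) (by rw [hGd, hd])
        (by rw [hFl, hGl, hlc]) hn hl z hz'
      have hc : (F x - G).coeff (d + 1) = ((P - Q).coeff (d + 1) : ℝ) := by
        simp only [F, G]
        rw [coeff_sub, coeff_map, coeff_map, coeff_add, coeff_C_of_ne_zero (by omega)]
        simp
      rw [hc, hGl] at this
      exact this
    by_cases hk : ((P - Q).coeff (d + 1) : ℝ) / (((d + 1 : ℕ) + 1) * Q.leadingCoeff) = 0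
    · obtain ⟨l, hn, hl, x, hx, z, hz⟩ := rpr_filter h (fun _ => ())
      have ht := key l hn hl x hx z (hz.mono fun y hy => ⟨hy.1, hy.2.1⟩)
      rw [hk] at ht
      have e1 := ht.eventually (Ioo_mem_nhds (show (-1 : ℝ) < 0 by norm_num) (show (0 : ℝ) < 1 by norm_num))
      have e2 : ∀ᶠ y : ℕ in l, (P + C ((a : ℤ) * (x : ℤ) ^ n) - Q).IsRoot (y : ℤ) := by
        filter_upwards [e1, hz] with y h1 h2
        have hzy : z y = y := by
          have h3 : ((z y : ℤ) : ℝ) - ((y : ℤ) : ℝ) < 1 := by simpa using h1.2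
          have h4 : -1 < ((z y : ℤ) : ℝ) - ((y : ℤ) : ℝ) := by simpa using h1.1
          have h5 : (z y : ℤ) - y < 1 := by exact_mod_cast h3
          have h6 : -1 < (z y : ℤ) - y := by exact_mod_cast h4
          omega
        have h3 := h2.2.1
        rw [hzy] at h3
        simp only [IsRoot, eval_sub, eval_add, eval_C]
        linarith
      have h0 : P + C ((a : ℤ) * (x : ℤ) ^ n) - Q = 0 := by
        by_contra hR
        have hfin : {y : ℤ | (P + C ((a : ℤ) * (x : ℤ) ^ n) - Q).IsRoot y}.Finite :=
          finite_setOfPred_isRoot hR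
        have hfin2 := hfin.preimage (f := fun y : ℕ => (y : ℤ)) (Nat.cast_injective.injOn)
        have e3 : ∀ᶠ y : ℕ in l, y ∉ ((fun y : ℕ => (y : ℤ)) ⁻¹' {y : ℤ | (P + C ((a : ℤ) * (x : ℤ) ^ n) - Q).IsRoot y}) := by
          apply hl
          rw [← Nat.cofinite_eq_atTop]
          exact hfin2.compl_mem_cofinite
        obtain ⟨y, h1, h2⟩ := (e2.and e3).exists
        exact h2 h1
      have := congrArg (fun R => R.eval 0) h0
      simp only [eval_sub, eval_add, eval_C, hP0, hQ0, eval_zero] at this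
      have h1 : (0 : ℤ) < (a : ℤ) * (x : ℤ) ^ n := by positivity
      omega
    · exact rpr_key h (fun x => (x : ℝ)) _ hk key
  have hPd1 : P.natDegree = 1 := by omega
  refine ⟨P.leadingCoeff, leadingCoeff_ne_zero.2 hP, ?_, ?_⟩
  · rw [leadingCoeff, hPd1]
    conv_lhs => rw [eq_X_add_C_of_natDegree_le_one hPd1.le]
    simp [hPc]
  · rw [hlc, leadingCoeff, hd1]
    conv_lhs => rw [eq_X_add_C_of_natDegree_le_one hd1.le]
    simp [hQc]

/-- The only equations of the shape `a·xⁿ + P(y) = Q(z)` that are Ramsey partition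
regular in `(x,y),z` over the positive integers are the multiples of `x + y = z` and
of `x − y = −z`. -/
theorem stmt_13 (P Q : Polynomial ℤ) (hP : P ≠ 0) (hQ : Q ≠ 0)
    (hP0 : P.eval 0 = 0) (hQ0 : Q.eval 0 = 0) (a n : ℕ) (ha : 0 < a) (hn : 0 < n) :
    RamseyPR (fun x y z => (a : ℤ) * (x : ℤ) ^ n + P.eval (y : ℤ) = Q.eval (z : ℤ)) ↔
      n = 1 ∧
        ((P = Polynomial.C (a : ℤ) * Polynomial.X ∧
            Q = Polynomial.C (a : ℤ) * Polynomial.X) ∨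
         (P = -(Polynomial.C (a : ℤ) * Polynomial.X) ∧
            Q = -(Polynomial.C (a : ℤ) * Polynomial.X))) := by
  constructor
  · intro h
    obtain ⟨p, hp, rfl, rfl⟩ := fwd P Q hP hQ hP0 hQ0 a n ha h
    simp only [Polynomial.eval_mul, Polynomial.eval_C, Polynomial.eval_X] at h
    obtain ⟨h1, h2⟩ := nt a n ha hn p hp h
    refine ⟨h1, ?_⟩
    rcases h2 with rfl | rfl
    · exact Or.inl ⟨rfl, rfl⟩
    · right; simp
  · have mono : ∀ φ ψ : ℕ → ℕ → ℕ → Prop, (∀ x y z, φ x y z → ψ x y z) → RamseyPR φ → RamseyPR ψ := by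
      intro φ ψ hi h r col
      obtain ⟨j, H, h1, h2, h3⟩ := h r col
      refine ⟨j, H, h1, h2, fun x hx y hy hxy => ?_⟩
      obtain ⟨z, hz, hφ⟩ := h3 x hx y hy hxy
      exact ⟨z, hz, hi _ _ _ hφ⟩
    rintro ⟨rfl, ⟨rfl, rfl⟩ | ⟨rfl, rfl⟩⟩
    · refine mono _ _ ?_ rpr_add
      rintro x y z rfl
      simp; ring
    · refine mono _ _ ?_ rpr_sub
      rintro x y z rfl
      simp; ring
end
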